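/- arXiv:2004.03058 — 4 statements merged into one kernel-verified Lean document; each statement's English description precedes it below -/
import Mathlib

section
/- Let s ∈ M_m be maximal (i.e., Φ(s) = Υ_m). Then for any two monic irreducible polynomials p and p' in F[x] with deg p > deg p', one has mult_p(s) ≤ mult_{p'}(s). -/
open Polynomial

/-- `Φ(s)`: the number of distinct monic divisors of `s` in `F[x]`. -/
noncomputable def numDiv {F : Type} [Field F] (s : F[X]) : ℕ :=
  Set.ncard {d : F[X] | d.Monic ∧ d ∣ s}

/-- `s` is maximal in `M_m`: `s` is monic of degree exactly `m` and `Φ(s) = Υ_m`,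
i.e. `Φ(s)` attains the maximum of `Φ` over all monic polynomials of degree at most `m`. -/
def IsMaximal {F : Type} [Field F] (m : ℕ) (s : F[X]) : Prop :=
  s.Monic ∧ s.natDegree = m ∧
    ∀ t : F[X], t.Monic → t.natDegree ≤ m → numDiv t ≤ numDiv s

theorem finite_monic_dvd {F : Type} [Field F] {s : F[X]} (hs : s ≠ 0) :
    {d : F[X] | d.Monic ∧ d ∣ s}.Finite := by
  classical
  refine ((Set.finite_Iic (UniqueFactorizationMonoid.normalizedFactors s)).image
    Multiset.prod).subset ?_
  rintro d ⟨hd, hds⟩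
  refine ⟨UniqueFactorizationMonoid.normalizedFactors d,
    (UniqueFactorizationMonoid.dvd_iff_normalizedFactors_le_normalizedFactors hd.ne_zero hs).1 hds,
    ?_⟩
  rw [UniqueFactorizationMonoid.prod_normalizedFactors_eq hd.ne_zero, hd.normalize_eq_self]

theorem exists_pow_mul_eq_of_dvd {F : Type} [Field F] {p u d : F[X]} {a : ℕ} (hp : p.Monic)
    (hirr : Irreducible p) (hd : d.Monic) (hdvd : d ∣ p ^ a * u) :
    ∃ i ≤ a, ∃ e : F[X], (e.Monic ∧ e ∣ u) ∧ p ^ i * e = d := by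
  obtain ⟨d₁, d₂, h₁, h₂, rfl⟩ := exists_dvd_and_dvd_of_dvd_mul hdvd
  obtain ⟨i, hi, hassoc⟩ := (dvd_prime_pow hirr.prime a).1 h₁
  obtain ⟨w, rfl⟩ : ∃ w : F[X]ˣ, p ^ i * w = d₁ := hassoc.symm
  rw [mul_assoc] at hd ⊢
  exact ⟨i, hi, w * d₂, ⟨(hp.pow i).of_mul_monic_left hd, Units.mul_left_dvd.2 h₂⟩, rfl⟩

theorem numDiv_pow_mul {F : Type} [Field F] {p u : F[X]} (hp : p.Monic) (hirr : Irreducible p)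
    (hpu : ¬p ∣ u) (a : ℕ) : numDiv (p ^ a * u) = (a + 1) * numDiv u := by
  have himage : {d : F[X] | d.Monic ∧ d ∣ p ^ a * u} =
      (fun x : ℕ × F[X] => p ^ x.1 * x.2) '' (Set.Iic a ×ˢ {d : F[X] | d.Monic ∧ d ∣ u}) := by
    refine Set.Subset.antisymm (fun d hd => ?_) ?_
    · obtain ⟨i, hi, e, he, heq⟩ := exists_pow_mul_eq_of_dvd hp hirr hd.1 hd.2
      exact ⟨(i, e), Set.mk_mem_prod hi he, heq⟩
    · refine Set.image_subset_iff.2 fun x hx => ?_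
      exact ⟨(hp.pow x.1).mul hx.2.1, mul_dvd_mul (pow_dvd_pow p hx.1) hx.2.2⟩
  have hinj : Set.InjOn (fun x : ℕ × F[X] => p ^ x.1 * x.2)
      (Set.Iic a ×ˢ {d : F[X] | d.Monic ∧ d ∣ u}) := by
    rintro ⟨i, d⟩ ⟨-, -, hd⟩ ⟨j, e⟩ ⟨-, -, he⟩ h
    have hmult : ∀ (k : ℕ) {c : F[X]}, c ∣ u → multiplicity p (p ^ k * c) = k := fun k c hc =>
      multiplicity_eq_of_dvd_of_not_dvd (dvd_mul_right _ _) fun hdvd => hpu <| by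
        rw [pow_succ] at hdvd
        exact ((mul_dvd_mul_iff_left (pow_ne_zero k hirr.ne_zero)).1 hdvd).trans hc
    dsimp only at h
    obtain rfl : i = j := by rw [← hmult i hd, h, hmult j he]
    rw [mul_left_cancel₀ (pow_ne_zero i hirr.ne_zero) h]
  rw [numDiv, himage, hinj.ncard_image, Set.ncard_prod, numDiv,
    ← Finset.coe_Iic, Set.ncard_coe_finset, Nat.card_Iic]

theorem numDiv_lt_numDiv_mul_X {F : Type} [Field F] {t : F[X]} (ht : t.Monic) :
    numDiv t < numDiv (t * X) := by
  refine Set.ncard_lt_ncard (Set.ssubset_iff_of_subset ?_ |>.2 ?_)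
    (finite_monic_dvd (ht.mul monic_X).ne_zero)
  · exact fun d hd => ⟨hd.1, hd.2.mul_right X⟩
  · refine ⟨t * X, ⟨ht.mul monic_X, dvd_rfl⟩, fun h => ?_⟩
    have := natDegree_le_of_dvd h.2 ht.ne_zero
    rw [natDegree_mul_X ht.ne_zero] at this
    omega

theorem not_dvd_pow_mul {F : Type} [Field F] {p q r : F[X]} (hp : p.Monic) (hpirr : Irreducible p)
    (hq : q.Monic) (hqirr : Irreducible q) (hne : p ≠ q) (hpr : ¬p ∣ r) (n : ℕ) :
    ¬p ∣ q ^ n * r := by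
  intro h
  rcases hpirr.prime.dvd_or_dvd h with h | h
  · exact hne (eq_of_monic_of_associated hp hq
      (hpirr.associated_of_dvd hqirr (hpirr.prime.dvd_of_dvd_pow h)))
  · exact hpr h

/-- Proposition 1: if `s ∈ M_m` is maximal and `p`, `p'` are monic irreducible with
`deg p > deg p'`, then `mult_p(s) ≤ mult_{p'}(s)`. -/
theorem mult_antitone_of_maximal {F : Type} [Field F] [Fintype F]
    (m : ℕ) (hm : 0 < m) (s : F[X]) (hs : IsMaximal m s)
    (p p' : F[X]) (hp : p.Monic) (hpirr : Irreducible p)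
    (hp' : p'.Monic) (hp'irr : Irreducible p')
    (hdeg : p'.natDegree < p.natDegree) :
    multiplicity p s ≤ multiplicity p' s := by
  obtain ⟨hsm, rfl, hmax⟩ := hs
  by_contra! hlt
  have hne : p ≠ p' := by rintro rfl; exact hdeg.false
  obtain ⟨w, hw, hpw⟩ :=
    (FiniteMultiplicity.of_not_isUnit hpirr.not_isUnit hsm.ne_zero).exists_eq_pow_mul_and_not_dvd
  have hw0 : w ≠ 0 := by rintro rfl; exact hpw (dvd_zero p)
  obtain ⟨r, hr, hp'r⟩ :=
    (FiniteMultiplicity.of_not_isUnit hp'irr.not_isUnit hw0).exists_eq_pow_mul_and_not_dvd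
  have hmult : multiplicity p' s = multiplicity p' w :=
    multiplicity_eq_of_dvd_of_not_dvd (hw ▸ (pow_multiplicity_dvd p' w).mul_left _) <| by
      rw [hw, hr, mul_left_comm, ← hr, pow_succ,
        mul_dvd_mul_iff_left (pow_ne_zero _ hp'irr.ne_zero)]
      exact not_dvd_pow_mul hp' hp'irr hp hpirr hne.symm hp'r _
  rw [← hmult] at hr
  generalize multiplicity p s = a at *
  generalize multiplicity p' s = b at *
  subst hr
  have hpr : ¬p ∣ r := fun h => hpw (h.mul_left _)
  have hrm : r.Monic := (hp'.pow b).of_mul_monic_left ((hp.pow a).of_mul_monic_left (hw ▸ hsm))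
  have htm : (p ^ b * (p' ^ a * r)).Monic := (hp.pow b).mul ((hp'.pow a).mul hrm)
  have hdiv : numDiv (p ^ b * (p' ^ a * r)) = numDiv s := by
    rw [hw, numDiv_pow_mul hp hpirr (not_dvd_pow_mul hp hpirr hp' hp'irr hne hpr _),
      numDiv_pow_mul hp hpirr (not_dvd_pow_mul hp hpirr hp' hp'irr hne hpr _),
      numDiv_pow_mul hp' hp'irr hp'r, numDiv_pow_mul hp' hp'irr hp'r]
    ring
  have hdegt : (p ^ b * (p' ^ a * r) * X).natDegree ≤ s.natDegree := by
    rw [natDegree_mul_X htm.ne_zero, hw, (hp.pow b).natDegree_mul ((hp'.pow a).mul hrm),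
      (hp.pow a).natDegree_mul ((hp'.pow b).mul hrm), (hp'.pow a).natDegree_mul hrm,
      (hp'.pow b).natDegree_mul hrm, hp.natDegree_pow, hp.natDegree_pow, hp'.natDegree_pow,
      hp'.natDegree_pow]
    nlinarith
  exact (hmax _ (htm.mul monic_X) hdegt).not_gt (hdiv ▸ numDiv_lt_numDiv_mul_X htm)
end

section
/- There exists an absolute constant C > 0 (independent of q and m) such that for every prime power q and every integer m ≥ q², log₂ Υ_m ≤ (m / log_q m) · (1 + C·(1 + log_q log_q m)/(log_q m)). -/
open Polynomial

/-- `Υ_m`: the maximum of `Φ(s)` over monic polynomials `s` of degree at most `m`. -/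
noncomputable def Upsilon (F : Type) [Field F] (m : ℕ) : ℕ :=
  sSup {k : ℕ | ∃ s : F[X], s.Monic ∧ s.natDegree ≤ m ∧ numDiv s = k}

namespace UniqueFactorizationMonoid

theorem normalizedFactors_injOn_monic_divisors {F : Type} [Field F] [DecidableEq F] (s : F[X]) :
    Set.InjOn normalizedFactors {d : F[X] | d.Monic ∧ d ∣ s} := by
  rintro d ⟨hd, -⟩ e ⟨he, -⟩ h
  rw [← hd.normalize_eq_self, ← he.normalize_eq_self,
    ← prod_normalizedFactors_eq hd.ne_zero, ← prod_normalizedFactors_eq he.ne_zero, h]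

theorem normalizedFactors_mapsTo_Iic {F : Type} [Field F] [DecidableEq F] {s : F[X]} (hs : s.Monic) :
    Set.MapsTo normalizedFactors {d : F[X] | d.Monic ∧ d ∣ s} (Set.Iic (normalizedFactors s)) :=
  fun _ ⟨hd, hds⟩ =>
    (dvd_iff_normalizedFactors_le_normalizedFactors hd.ne_zero hs.ne_zero).1 hds

end UniqueFactorizationMonoid

open UniqueFactorizationMonoid in
/-- The number of monic divisors is at most the product of the incremented multiplicities. -/
theorem numDiv_le_prod {F : Type} [Field F] [DecidableEq F] {s : F[X]} (hs : s.Monic) :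
    numDiv s ≤ ∏ p ∈ (normalizedFactors s).toFinset, ((normalizedFactors s).count p + 1) := by
  rw [← Multiset.card_Iic, ← Set.ncard_coe_finset, Finset.coe_Iic]
  exact Set.ncard_le_ncard_of_injOn _ (normalizedFactors_mapsTo_Iic hs)
    (normalizedFactors_injOn_monic_divisors s) (Set.finite_Iic _)

open UniqueFactorizationMonoid in
theorem numDiv_pos {F : Type} [Field F] {s : F[X]} (hs : s.Monic) : 0 < numDiv s := by
  classical
  exact (Set.ncard_pos (Set.Finite.of_injOn (normalizedFactors_mapsTo_Iic hs)
    (normalizedFactors_injOn_monic_divisors s) (Set.finite_Iic _))).2 ⟨s, hs, dvd_rfl⟩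

open UniqueFactorizationMonoid in
theorem sum_count_mul_natDegree_normalizedFactors {F : Type} [Field F] [DecidableEq F]
    {s : F[X]} (hs : s.Monic) :
    ∑ p ∈ (normalizedFactors s).toFinset, (normalizedFactors s).count p * p.natDegree
      = s.natDegree := by
  have h0 : (0 : F[X]) ∉ normalizedFactors s := zero_notMem_normalizedFactors s
  conv_rhs => rw [← hs.normalize_eq_self, ← prod_normalizedFactors_eq hs.ne_zero,
    natDegree_multiset_prod _ h0, Finset.sum_multiset_map_count]
  simp

theorem card_le_of_natDegree_lt {F : Type} [Field F] [Fintype F] (T : Finset F[X]) (k : ℕ)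
    (hT : ∀ p ∈ T, p.degree < k) : T.card ≤ Fintype.card F ^ k := by
  have h : T.card ≤ (Finset.univ : Finset (Fin k → F)).card := by
    refine Finset.card_le_card_of_injOn (fun p i => p.coeff i) (by simp) ?_
    intro p hp r hr h
    ext i
    by_cases hi : i < k
    · exact congrFun h ⟨i, hi⟩
    · have hi' : (k : WithBot ℕ) ≤ i := by exact_mod_cast not_lt.1 hi
      rw [coeff_eq_zero_of_degree_lt ((hT p hp).trans_le hi'),
        coeff_eq_zero_of_degree_lt ((hT r hr).trans_le hi')]
  simpa using h

theorem logb_two_add_one_le (a : ℕ) : Real.logb 2 (a + 1) ≤ a := by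
  rw [Real.logb_le_iff_le_rpow (by norm_num) (by positivity), Real.rpow_natCast]
  exact_mod_cast Nat.lt_two_pow_self (n := a)

open UniqueFactorizationMonoid in
/-- Splitting the prime factors at degree `k`. -/
theorem logb_numDiv_le {F : Type} [Field F] [Fintype F] {s : F[X]} (hs : s.Monic) {m k : ℕ}
    (hm : s.natDegree ≤ m) (hk : 0 < k) :
    Real.logb 2 (numDiv s) ≤
      (m : ℝ) / k + (Fintype.card F : ℝ) ^ k * Real.logb 2 (m + 1) := by
  classical
  set S := normalizedFactors s
  have hkR : (0 : ℝ) < k := by exact_mod_cast hk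
  have hlogm : 0 ≤ Real.logb 2 ((m : ℝ) + 1) := Real.logb_nonneg (by norm_num) (by simp)
  have hsum := sum_count_mul_natDegree_normalizedFactors hs
  have hprime : ∀ p ∈ S.toFinset, 1 ≤ p.natDegree := fun p hp =>
    (irreducible_of_normalized_factor p (Multiset.mem_toFinset.1 hp)).natDegree_pos
  have hcount : ∀ p ∈ S.toFinset, S.count p ≤ m := fun p hp =>
    calc S.count p ≤ S.count p * p.natDegree := Nat.le_mul_of_pos_right _ (hprime p hp)
      _ ≤ ∑ p ∈ S.toFinset, S.count p * p.natDegree :=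
        Finset.single_le_sum (f := fun p => S.count p * p.natDegree)
          (fun _ _ => Nat.zero_le _) hp
      _ ≤ m := hsum.trans_le hm
  have hterm : ∀ p ∈ S.toFinset, Real.logb 2 ((S.count p : ℝ) + 1) ≤
      (S.count p * p.natDegree : ℝ) / k +
        if p.degree < k then Real.logb 2 ((m : ℝ) + 1) else 0 := by
    intro p hp
    split_ifs with h
    · have : Real.logb 2 ((S.count p : ℝ) + 1) ≤ Real.logb 2 ((m : ℝ) + 1) := by
        apply Real.logb_le_logb_of_le (by norm_num) (by positivity)
        exact_mod_cast Nat.succ_le_succ (hcount p hp)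
      have : (0 : ℝ) ≤ (S.count p * p.natDegree : ℝ) / k := by positivity
      linarith
    · have hdeg : (k : ℝ) ≤ p.natDegree := by
        exact_mod_cast le_natDegree_of_coe_le_degree (not_lt.1 h)
      rw [add_zero, le_div_iff₀ hkR]
      calc Real.logb 2 ((S.count p : ℝ) + 1) * k ≤ S.count p * k := by
            gcongr; exact logb_two_add_one_le _
        _ ≤ S.count p * p.natDegree := by gcongr
  calc Real.logb 2 (numDiv s)
      ≤ Real.logb 2 (∏ p ∈ S.toFinset, ((S.count p : ℝ) + 1)) := by
        apply Real.logb_le_logb_of_le (by norm_num)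
        · exact_mod_cast numDiv_pos hs
        · exact_mod_cast numDiv_le_prod hs
    _ = ∑ p ∈ S.toFinset, Real.logb 2 ((S.count p : ℝ) + 1) :=
        Real.logb_prod _ _ fun p _ => by positivity
    _ ≤ ∑ p ∈ S.toFinset, ((S.count p * p.natDegree : ℝ) / k +
        if p.degree < k then Real.logb 2 ((m : ℝ) + 1) else 0) := Finset.sum_le_sum hterm
    _ = (s.natDegree : ℝ) / k +
        ({p ∈ S.toFinset | p.degree < (k : WithBot ℕ)} : Finset F[X]).card * Real.logb 2 ((m : ℝ) + 1) := by
        rw [Finset.sum_add_distrib, ← Finset.sum_div, ← Finset.sum_filter, Finset.sum_const,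
          nsmul_eq_mul, ← hsum]
        push_cast
        rfl
    _ ≤ (m : ℝ) / k + (Fintype.card F : ℝ) ^ k * Real.logb 2 (m + 1) := by
        gcongr
        exact_mod_cast card_le_of_natDegree_lt _ k fun p hp => (Finset.mem_filter.1 hp).2

theorem logb_Upsilon_le {F : Type} [Field F] [Fintype F] {m k : ℕ} (hk : 0 < k) :
    Real.logb 2 (Upsilon F m) ≤
      (m : ℝ) / k + (Fintype.card F : ℝ) ^ k * Real.logb 2 (m + 1) := by
  set R := (m : ℝ) / k + (Fintype.card F : ℝ) ^ k * Real.logb 2 (m + 1)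
  set A := {n : ℕ | ∃ s : F[X], s.Monic ∧ s.natDegree ≤ m ∧ numDiv s = n}
  have hne : A.Nonempty := ⟨_, 1, monic_one, by simp, rfl⟩
  have hbdd : BddAbove A := by
    refine ⟨⌊(2 : ℝ) ^ R⌋₊, ?_⟩
    rintro _ ⟨s, hs, hm, rfl⟩
    refine Nat.le_floor ((Real.logb_le_iff_le_rpow (by norm_num) ?_).1 (logb_numDiv_le hs hm hk))
    exact_mod_cast numDiv_pos hs
  obtain ⟨s, hs, hm, h⟩ : Upsilon F m ∈ A := Nat.sSup_mem hne hbdd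
  rw [← h]
  exact logb_numDiv_le hs hm hk

theorem logb_two_le_three_mul_sqrt {x : ℝ} (hx : 0 ≤ x) : Real.logb 2 x ≤ 3 * √x := by
  have h := Real.log_le_rpow_div hx (ε := 1 / 2) (by norm_num)
  rw [← Real.sqrt_eq_rpow] at h
  have h2 := Real.log_two_gt_d9
  rw [Real.logb, div_le_iff₀ (by linarith)]
  nlinarith [Real.sqrt_nonneg x]

/-- Theorem 1: there is an absolute constant `C > 0` such that for every finite field `F`
(of prime-power size `q = |F|`) and every integer `m ≥ q²`,
`log₂ Υ_m ≤ (m / log_q m) · (1 + C·(1 + log_q log_q m)/(log_q m))`. -/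
theorem upsilon_upper_bound :
    ∃ C : ℝ, 0 < C ∧
      ∀ (F : Type) [Field F] [Fintype F], ∀ m : ℕ, Fintype.card F ^ 2 ≤ m →
        Real.logb 2 (Upsilon F m) ≤
          ((m : ℝ) / Real.logb (Fintype.card F) m) *
            (1 + C * (1 + Real.logb (Fintype.card F) (Real.logb (Fintype.card F) m)) /
              Real.logb (Fintype.card F) m) := by
  refine ⟨1000000, by norm_num, ?_⟩
  intro F _ _ m hm
  have hq2 : 2 ≤ Fintype.card F := Fintype.one_lt_card
  have hU := fun k (hk : 0 < k) => logb_Upsilon_le (F := F) (m := m) hk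
  generalize Fintype.card F = q at *
  generalize Real.logb 2 (Upsilon F m) = U at *
  have hq : (2 : ℝ) ≤ q := by exact_mod_cast hq2
  have hq1 : (1 : ℝ) < q := by linarith
  have hmq : (q : ℝ) ^ 2 ≤ m := by exact_mod_cast hm
  have hm4 : (4 : ℝ) ≤ m := by nlinarith
  have hm0 : (0 : ℝ) < m := by linarith
  set L := Real.logb q m with hLdef
  have hqL : (q : ℝ) ^ L = m := Real.rpow_logb (by linarith) hq1.ne' hm0
  have hL2 : 2 ≤ L := by
    rw [hLdef, Real.le_logb_iff_rpow_le hq1 hm0]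
    exact_mod_cast hmq
  have hL0 : 0 < L := by linarith
  set u := Real.logb q L with hudef
  have hqu : (q : ℝ) ^ u = L := Real.rpow_logb (by linarith) hq1.ne' hL0
  have hu0 : 0 ≤ u := Real.logb_nonneg hq1 (by linarith)
  have hrhs : (m : ℝ) / L * (1 + 1000000 * (1 + u) / L)
      = m / L + m / L ^ 2 * (1000000 * (1 + u)) := by field_simp
  rw [hrhs]
  rcases lt_or_ge L (6 * u + 4) with hlt | hge
  · have hu : u ≤ 3 * √L := by
      refine le_trans ?_ (logb_two_le_three_mul_sqrt hL0.le)
      rw [hudef, Real.logb, Real.logb]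
      have := Real.log_nonneg (show 1 ≤ L by linarith)
      gcongr
    have hsq := Real.sq_sqrt hL0.le
    have hs19 : √L ≤ 19 := by nlinarith [Real.sqrt_nonneg L]
    have hL361 : L ≤ 361 := by nlinarith [Real.sqrt_nonneg L]
    have h7 : U ≤ 7 * m := by
      have h1 := hU 1 one_pos
      have h2 := logb_two_le_three_mul_sqrt (show (0 : ℝ) ≤ m + 1 by linarith)
      have h3 : (q : ℝ) ≤ √(m + 1) := Real.le_sqrt_of_sq_le (by linarith)
      have h4 := Real.sq_sqrt (show (0 : ℝ) ≤ m + 1 by linarith)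
      have h5 : (q : ℝ) * Real.logb 2 (m + 1) ≤ √(m + 1) * (3 * √(m + 1)) := by
        gcongr
        exact Real.logb_nonneg (by norm_num) (by linarith)
      simp only [Nat.cast_one, div_one, pow_one] at h1
      nlinarith
    have h8 : 7 * (m : ℝ) ≤ m / L ^ 2 * (1000000 * (1 + u)) := by
      rw [div_mul_eq_mul_div, le_div_iff₀ (by positivity)]
      have : 7 * L ^ 2 ≤ 1000000 * (1 + u) := by nlinarith
      nlinarith
    have : 0 ≤ (m : ℝ) / L := by positivity
    linarith
  · set y := L - 3 * u - 1 with hy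
    set k := ⌊y⌋₊
    have hky : (k : ℝ) ≤ y := Nat.floor_le (by linarith)
    have hyk : y < k + 1 := Nat.lt_floor_add_one y
    have hk2 : L / 2 ≤ k := by linarith
    have hk0 : (0 : ℝ) < k := by linarith
    have h1 := hU k (by exact_mod_cast hk0)
    have hfirst : (m : ℝ) / k ≤ m / L + m / L ^ 2 * (6 * u + 4) := by
      have : (1 : ℝ) / k ≤ 1 / L + (6 * u + 4) / L ^ 2 := by
        rw [div_add_div _ _ (by positivity) (by positivity),
          div_le_div_iff₀ hk0 (by positivity)]
        have : L ^ 2 ≤ (L + (6 * u + 4)) * k := by nlinarith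
        nlinarith
      calc (m : ℝ) / k = m * (1 / k) := by ring
        _ ≤ m * (1 / L + (6 * u + 4) / L ^ 2) := by gcongr
        _ = _ := by ring
    have hpow : (q : ℝ) ^ k ≤ m / (L ^ 3 * q) := by
      calc (q : ℝ) ^ k = (q : ℝ) ^ (k : ℝ) := (Real.rpow_natCast _ _).symm
        _ ≤ (q : ℝ) ^ y := Real.rpow_le_rpow_of_exponent_le hq1.le hky
        _ = m / (L ^ 3 * q) := by
          rw [hy, Real.rpow_sub (by linarith), Real.rpow_sub (by linarith), hqL, Real.rpow_one,
            mul_comm 3 u, Real.rpow_mul (by linarith), hqu, div_div]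
          norm_num
    have hlog : Real.logb 2 ((m : ℝ) + 1) ≤ 2 * L * q := by
      have hlq : Real.logb 2 q ≤ q := by
        refine le_trans ?_ (logb_two_add_one_le q)
        exact Real.logb_le_logb_of_le (by norm_num) (by linarith) (by linarith)
      calc Real.logb 2 ((m : ℝ) + 1) ≤ Real.logb 2 ((m : ℝ) ^ 2) :=
            Real.logb_le_logb_of_le (by norm_num) (by linarith) (by nlinarith)
        _ = 2 * (L * Real.logb 2 q) := by
            rw [Real.logb_pow, hLdef, mul_comm (Real.logb (q : ℝ) m),
              Real.mul_logb (by linarith) (by linarith) (by linarith)]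
            norm_num
        _ ≤ 2 * (L * q) := by gcongr
        _ = _ := by ring
    have hsecond : (q : ℝ) ^ k * Real.logb 2 (m + 1) ≤ m / L ^ 2 * 2 := by
      calc (q : ℝ) ^ k * Real.logb 2 (m + 1) ≤ m / (L ^ 3 * q) * (2 * L * q) := by
            gcongr
            exact Real.logb_nonneg (by norm_num) (by linarith)
        _ = _ := by field_simp
    have : (0 : ℝ) ≤ m / L ^ 2 := by positivity
    nlinarith
end

section
/- There exists an absolute constant C > 0 (independent of q and n) such that for every prime power q and every integer n ≥ 2, log₂ Υ_{n,n} ≥ (2n / log_q n) · (1 − C/log_q n). -/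
open Polynomial

/-- `Φ_n(s)`: the number of ordered pairs `(u,v)` of monic polynomials of degree at most `n`
with `s = u·v`. -/
noncomputable def PhiN {F : Type} [Field F] (n : ℕ) (s : F[X]) : ℕ :=
  Set.ncard {uv : F[X] × F[X] | uv.1.Monic ∧ uv.1.natDegree ≤ n ∧
    uv.2.Monic ∧ uv.2.natDegree ≤ n ∧ s = uv.1 * uv.2}

/-- `Υ_{n,n}`: the maximum of `Φ_n(s)` over monic polynomials `s` of degree at most `2n`. -/
noncomputable def UpsilonNN (F : Type) [Field F] (n : ℕ) : ℕ :=
  sSup {k : ℕ | ∃ s : F[X], s.Monic ∧ s.natDegree ≤ 2 * n ∧ PhiN n s = k}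

theorem finite_natDegree_le (F : Type) [Field F] [Finite F] (n : ℕ) :
    {p : F[X] | p.natDegree ≤ n}.Finite := by
  refine Set.Finite.of_finite_image (f := fun p (i : Fin (n + 1)) => p.coeff i)
    (Set.toFinite _) ?_
  intro p hp r hr h
  ext i
  by_cases hi : i ≤ n
  · exact congrFun h ⟨i, Nat.lt_succ_of_le hi⟩
  · simp only [Set.mem_ofPred_eq] at hp hr
    rw [coeff_eq_zero_of_natDegree_lt (by lia), coeff_eq_zero_of_natDegree_lt (by lia)]

theorem finite_factorizations {F : Type} [Field F] [Finite F] (n : ℕ) (s : F[X]) :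
    {uv : F[X] × F[X] | uv.1.Monic ∧ uv.1.natDegree ≤ n ∧
      uv.2.Monic ∧ uv.2.natDegree ≤ n ∧ s = uv.1 * uv.2}.Finite :=
  ((finite_natDegree_le F n).prod (finite_natDegree_le F n)).subset
    fun _ h => ⟨h.2.1, h.2.2.2.1⟩

theorem PhiN_le_UpsilonNN {F : Type} [Field F] [Finite F] {n : ℕ} {s : F[X]}
    (hs : s.Monic) (hdeg : s.natDegree ≤ 2 * n) : PhiN n s ≤ UpsilonNN F n := by
  refine le_csSup ⟨({p : F[X] | p.natDegree ≤ n} ×ˢ {p : F[X] | p.natDegree ≤ n}).ncard, ?_⟩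
    ⟨s, hs, hdeg, rfl⟩
  rintro _ ⟨r, -, -, rfl⟩
  exact Set.ncard_le_ncard (fun _ h => ⟨h.2.1, h.2.2.2.1⟩)
    ((finite_natDegree_le F n).prod (finite_natDegree_le F n))

theorem mem_iff_dvd_prod_of_monic_irreducible {F : Type} [Field F] {A : Finset F[X]}
    (hA : ∀ p ∈ A, p.Monic ∧ Irreducible p) {p : F[X]} (hp : p.Monic) (hirr : Irreducible p) :
    p ∈ A ↔ p ∣ ∏ r ∈ A, r := by
  refine ⟨fun h => Finset.dvd_prod_of_mem _ h, fun h => ?_⟩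
  obtain ⟨r, hr, hpr⟩ := hirr.prime.exists_mem_finset_dvd h
  rwa [eq_of_monic_of_associated hp (hA r hr).1 (hirr.associated_of_dvd (hA r hr).2 hpr)]

theorem centralBinom_le_UpsilonNN {F : Type} [Field F] [Finite F] {n m t : ℕ} (htm : t * m ≤ n)
    (S : Finset F[X]) (hS : ∀ p ∈ S, p.Monic ∧ Irreducible p ∧ p.natDegree = m)
    (hcard : S.card = 2 * t) : t.centralBinom ≤ UpsilonNN F n := by
  classical
  have hmonic {A : Finset F[X]} (hA : A ⊆ S) : (∏ p ∈ A, p).Monic :=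
    monic_prod_of_monic _ _ fun p hp => (hS p (hA hp)).1
  have hdeg {A : Finset F[X]} (hA : A ⊆ S) : (∏ p ∈ A, p).natDegree = A.card * m := by
    rw [natDegree_prod_of_monic _ _ fun p hp => (hS p (hA hp)).1,
      Finset.sum_const_nat fun p hp => (hS p (hA hp)).2.2]
  refine le_trans ?_ (PhiN_le_UpsilonNN (s := ∏ p ∈ S, p) (hmonic subset_rfl) ?_)
  · rw [Nat.centralBinom, ← hcard, ← Finset.card_powersetCard, ← Set.ncard_coe_finset, PhiN]
    refine Set.ncard_le_ncard_of_injOn (fun A => (∏ p ∈ A, p, ∏ p ∈ S \ A, p)) ?_ ?_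
      (finite_factorizations n _)
    · intro A hA
      obtain ⟨hAS, hAc⟩ := Finset.mem_powersetCard.1 (Finset.mem_coe.1 hA)
      have hc : (S \ A).card = t := by rw [Finset.card_sdiff_of_subset hAS]; lia
      refine ⟨hmonic hAS, ?_, hmonic Finset.sdiff_subset, ?_, ?_⟩
      · rw [hdeg hAS, hAc]; exact htm
      · rw [hdeg Finset.sdiff_subset, hc]; exact htm
      · simp only; rw [mul_comm, Finset.prod_sdiff hAS]
    · intro A hA B hB hAB
      have hAS := (Finset.mem_powersetCard.1 (Finset.mem_coe.1 hA)).1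
      have hBS := (Finset.mem_powersetCard.1 (Finset.mem_coe.1 hB)).1
      have hprod : ∏ p ∈ A, p = ∏ p ∈ B, p := congrArg Prod.fst hAB
      have hirr {D : Finset F[X]} (hD : D ⊆ S) : ∀ p ∈ D, p.Monic ∧ Irreducible p :=
        fun p hp => ⟨(hS p (hD hp)).1, (hS p (hD hp)).2.1⟩
      refine Finset.Subset.antisymm (fun p hp => ?_) fun p hp => ?_
      · have h := hirr hAS p hp
        rwa [mem_iff_dvd_prod_of_monic_irreducible (hirr hBS) h.1 h.2, ← hprod,
          ← mem_iff_dvd_prod_of_monic_irreducible (hirr hAS) h.1 h.2]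
      · have h := hirr hBS p hp
        rwa [mem_iff_dvd_prod_of_monic_irreducible (hirr hAS) h.1 h.2, hprod,
          ← mem_iff_dvd_prod_of_monic_irreducible (hirr hBS) h.1 h.2]
  · rw [hdeg subset_rfl, hcard]
    nlinarith

theorem pow_card_pow_natDegree_minpoly {F K : Type*} [Field F] [Fintype F] [Field K] [Finite K]
    [Algebra F K] (a : K) : a ^ Fintype.card F ^ (minpoly F a).natDegree = a := by
  have ha : IsIntegral F a := Algebra.IsIntegral.isIntegral a
  let := Fintype.ofFinite (IntermediateField.adjoin F {a})
  have h := FiniteField.pow_card (IntermediateField.AdjoinSimple.gen F a)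
  rw [Module.card_eq_pow_finrank (K := F), IntermediateField.adjoin.finrank ha] at h
  simpa using congrArg (algebraMap _ K) h

theorem card_filter_natDegree_minpoly_le {F K : Type*} [Field F] [Fintype F] [Field K]
    [Fintype K] [Algebra F K] {d : ℕ} (hd : d ≠ 0) :
    (Finset.univ.filter fun a : K => (minpoly F a).natDegree = d).card ≤ Fintype.card F ^ d := by
  classical
  have hq : 1 < Fintype.card F := Fintype.one_lt_card
  have h0 := FiniteField.X_pow_card_pow_sub_X_ne_zero K hd hq
  rw [← FiniteField.X_pow_card_pow_sub_X_natDegree_eq K hd hq]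
  refine le_trans (Finset.card_le_card fun a ha => ?_) ((Multiset.toFinset_card_le _).trans
    (card_roots' _))
  obtain rfl : (minpoly F a).natDegree = d := by simpa using ha
  simp [mem_roots h0, pow_card_pow_natDegree_minpoly, IsRoot]

theorem exists_finset_monic_irreducible (F : Type) [Field F] [Fintype F] {m : ℕ} (hm : 3 ≤ m) :
    ∃ S : Finset F[X], (∀ p ∈ S, p.Monic ∧ Irreducible p ∧ p.natDegree = m) ∧
      Fintype.card F ^ (m - 1) ≤ m * S.card := by
  classical
  obtain ⟨p, hp⟩ := CharP.exists F
  have : Fact p.Prime := ⟨CharP.char_is_prime F p⟩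
  have : NeZero m := ⟨by lia⟩
  let K := FiniteField.Extension F p m
  let : Fintype K := Fintype.ofFinite K
  have hq : 2 ≤ Fintype.card F := Fintype.one_lt_card
  have hK : Fintype.card K = Fintype.card F ^ m := by
    rw [Module.card_eq_pow_finrank (K := F), FiniteField.finrank_extension]
  have hint (a : K) : IsIntegral F a := Algebra.IsIntegral.isIntegral a
  let G : Finset K := Finset.univ.filter fun a => (minpoly F a).natDegree = m
  let B : Finset K := Finset.univ.filter fun a => ¬ (minpoly F a).natDegree = m
  have hGB : G.card + B.card = Fintype.card F ^ m := by
    rw [← hK, ← Finset.card_univ]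
    exact Finset.card_filter_add_card_filter_not _
  have hB : B.card ≤ Fintype.card F ^ (m - 1) := by
    have hmaps : ∀ a ∈ B, (minpoly F a).natDegree ∈ Finset.Icc 1 (m / 2) := by
      intro a ha
      have hne : ¬ (minpoly F a).natDegree = m := by simpa [B] using ha
      have hdvd : (minpoly F a).natDegree ∣ m := by
        simpa [K, FiniteField.finrank_extension] using minpoly.degree_dvd (hint a)
      obtain ⟨k, hk⟩ := hdvd
      have hpos := minpoly.natDegree_pos (hint a)
      rw [Finset.mem_Icc, Nat.le_div_iff_mul_le two_pos]
      refine ⟨hpos, ?_⟩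
      have h2 : 2 ≤ k := by
        rcases k with _ | _ | k <;> lia
      calc _ ≤ (minpoly F a).natDegree * k := Nat.mul_le_mul_left _ h2
        _ = m := hk.symm
    rw [Finset.card_eq_sum_card_fiberwise hmaps]
    calc ∑ d ∈ Finset.Icc 1 (m / 2), (B.filter fun a => (minpoly F a).natDegree = d).card
        ≤ ∑ d ∈ Finset.Icc 1 (m / 2), Fintype.card F ^ d := by
          refine Finset.sum_le_sum fun d hd => ?_
          refine (Finset.card_le_card ?_).trans (card_filter_natDegree_minpoly_le (F := F) (K := K)
            (by have := (Finset.mem_Icc.1 hd).1; lia))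
          exact Finset.filter_subset_filter _ (Finset.subset_univ _)
      _ ≤ Fintype.card F ^ (m - 1) :=
          (Nat.geomSum_lt hq fun k hk => by have := (Finset.mem_Icc.1 hk).2; lia).le
  have hpow : 2 * Fintype.card F ^ (m - 1) ≤ Fintype.card F ^ m := by
    conv_rhs => rw [show m = (m - 1) + 1 by lia, pow_succ']
    exact Nat.mul_le_mul_right _ hq
  refine ⟨G.image (minpoly F), ?_, ?_⟩
  · intro r hr
    obtain ⟨a, ha, rfl⟩ := Finset.mem_image.1 hr
    exact ⟨minpoly.monic (hint a), minpoly.irreducible (hint a), by simpa [G] using ha⟩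
  · refine le_trans (by lia) (Finset.card_le_mul_card_image (f := minpoly F) G m fun r hr => ?_)
    obtain ⟨a, ha, rfl⟩ := Finset.mem_image.1 hr
    have hdeg : (minpoly F a).natDegree = m := by simpa [G] using ha
    have h0 : (minpoly F a).map (algebraMap F K) ≠ 0 :=
      ((minpoly.monic (hint a)).map _).ne_zero
    calc _ ≤ ((minpoly F a).map (algebraMap F K)).roots.toFinset.card := by
          refine Finset.card_le_card fun b hb => ?_
          have hb' := (Finset.mem_filter.1 hb).2
          rw [Multiset.mem_toFinset, mem_roots h0, ← hb', IsRoot, eval_map_algebraMap,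
            minpoly.aeval]
      _ ≤ ((minpoly F a).map (algebraMap F K)).natDegree :=
          (Multiset.toFinset_card_le _).trans (card_roots' _)
      _ = m := by rw [natDegree_map, hdeg]

theorem logb_two_pow_three_le {x : ℝ} (hx : 1 ≤ x) : Real.logb 2 x ^ 3 ≤ 48 * x := by
  have hl : 0 ≤ Real.log x := Real.log_nonneg hx
  have h := Real.pow_div_factorial_le_exp _ hl 3
  rw [Real.exp_log (by linarith)] at h
  norm_num [Nat.factorial] at h
  have h2 : Real.logb 2 x ≤ 2 * Real.log x := by
    rw [Real.logb, div_le_iff₀ (Real.log_pos one_lt_two)]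
    nlinarith [Real.log_two_gt_d9]
  calc Real.logb 2 x ^ 3 ≤ (2 * Real.log x) ^ 3 :=
        pow_le_pow_left₀ (Real.logb_nonneg one_lt_two hx) h2 3
    _ ≤ 48 * x := by linarith [mul_pow 2 (Real.log x) 3]

theorem main_term_le {n L l m t : ℝ} (hn : 0 ≤ n) (hL : 1 ≤ L) (hLl : L ≤ l)
    (hl : l ^ 3 ≤ 48 * n) (hm : 0 < m) (hmL : m ≤ L + 3) (ht : n / m - 1 ≤ t) :
    2 * n / L * (1 - 100 / L) ≤ 2 * t - (1 + l) := by
  have hL0 : 0 < L := by linarith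
  have h1 : n / (L + 3) ≤ n / m := div_le_div_of_nonneg_left hn hm hmL
  have h2 : n / L * (1 - 3 / L) ≤ n / (L + 3) := by
    rw [le_div_iff₀ (by linarith), show n / L * (1 - 3 / L) * (L + 3) = n - 9 * n / L ^ 2 by
      field_simp; ring]
    have : 0 ≤ 9 * n / L ^ 2 := by positivity
    linarith
  have h3 : 3 + l ≤ 2 * n / L * (97 / L) := by
    rw [show 2 * n / L * (97 / L) = 194 * n / L ^ 2 by field_simp; ring,
      le_div_iff₀ (by positivity)]
    calc (3 + l) * L ^ 2 ≤ (4 * l) * l ^ 2 := by gcongr <;> linarith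
      _ ≤ 194 * n := by linarith [show 4 * l * l ^ 2 = 4 * l ^ 3 by ring]
  have h4 : 2 * n / L * (1 - 100 / L) = 2 * (n / L * (1 - 3 / L)) - 2 * n / L * (97 / L) := by
    ring
  linarith

theorem two_mul_sub_logb_le_logb_centralBinom {n t : ℕ} (hn : 1 ≤ n) (htn : t ≤ n) :
    2 * (t : ℝ) - (1 + Real.logb 2 n) ≤ Real.logb 2 t.centralBinom := by
  have hn0 : (n : ℝ) ≠ 0 := by positivity
  have hc0 : (t.centralBinom : ℝ) ≠ 0 := by exact_mod_cast t.centralBinom_ne_zero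
  have h : 4 ^ t ≤ 2 * n * t.centralBinom := by
    rcases t.eq_zero_or_pos with rfl | ht
    · simp; lia
    · exact (Nat.four_pow_le_two_mul_self_mul_centralBinom t ht).trans (by gcongr)
  have h' : ((4 : ℝ) ^ t) ≤ 2 * n * t.centralBinom := by exact_mod_cast h
  have h2 := Real.logb_le_logb_of_le one_lt_two (by positivity) h'
  rw [Real.logb_mul (by positivity) hc0, Real.logb_mul two_ne_zero hn0,
    Real.logb_self_eq_one one_lt_two, show (4 : ℝ) = 2 ^ 2 by norm_num, ← pow_mul,
    Real.logb_pow, Real.logb_self_eq_one one_lt_two] at h2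
  push_cast at h2
  linarith

/-- Theorem 2: there is an absolute constant `C > 0` such that for every finite field `F`
(of prime-power size `q = |F|`) and every integer `n ≥ 2`,
`log₂ Υ_{n,n} ≥ (2n / log_q n) · (1 − C/log_q n)`. -/
theorem upsilonNN_lower_bound :
    ∃ C : ℝ, 0 < C ∧
      ∀ (F : Type) [Field F] [Fintype F], ∀ n : ℕ, 2 ≤ n →
        (2 * (n : ℝ) / Real.logb (Fintype.card F) n) *
            (1 - C / Real.logb (Fintype.card F) n) ≤
          Real.logb 2 (UpsilonNN F n) := by
  refine ⟨100, by norm_num, fun F _ _ n hn => ?_⟩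
  have hq : 2 ≤ Fintype.card F := Fintype.one_lt_card
  set q := Fintype.card F
  have hqR : (2 : ℝ) ≤ q := by exact_mod_cast hq
  have hq1 : (1 : ℝ) < q := by linarith
  have hnR : (2 : ℝ) ≤ n := by exact_mod_cast hn
  have hLpos : 0 < Real.logb q n := Real.logb_pos hq1 (by linarith)
  rcases le_or_gt (Real.logb q n) 100 with hL | hL
  · have h1 : 1 - 100 / Real.logb q n ≤ 0 := by
      rw [sub_nonpos, le_div_iff₀ hLpos]; linarith
    exact (mul_nonpos_of_nonneg_of_nonpos (by positivity) h1).trans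
      (div_nonneg (Real.log_natCast_nonneg _) (Real.log_pos one_lt_two).le)
  have hLl : Real.logb q n ≤ Real.logb 2 n :=
    div_le_div_of_nonneg_left (Real.log_nonneg (by linarith)) (Real.log_pos one_lt_two)
      (Real.log_le_log two_pos hqR)
  have hqn : q < n := by
    have : (q : ℝ) < n := by
      have h := (Real.lt_logb_iff_rpow_lt hq1 (by linarith : (0 : ℝ) < n)).1
        (show 1 < Real.logb q n by linarith)
      simpa using h
    exact_mod_cast this
  set c := Nat.clog q (2 * n)
  have hc2 : 2 ≤ c := (Nat.lt_clog_iff_pow_lt hq).2 (by lia)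
  have hcL : (c : ℝ) - 1 ≤ Real.logb q n + 1 := by
    have h : q ^ (c - 1) < 2 * n := Nat.pow_pred_clog_lt_self hq (by lia)
    have h' : (q : ℝ) ^ (c - 1) ≤ 2 * n := by exact_mod_cast h.le
    have h2 := Real.logb_le_logb_of_le hq1 (by positivity) h'
    rw [Real.logb_pow, Real.logb_self_eq_one hq1, Real.logb_mul two_ne_zero (by linarith),
      Nat.cast_sub (by lia)] at h2
    have h3 : Real.logb q 2 ≤ 1 := by
      rw [← Real.logb_self_eq_one hq1]
      exact Real.logb_le_logb_of_le hq1 two_pos hqR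
    push_cast at h2
    linarith
  obtain ⟨S, hS, hcard⟩ := exists_finset_monic_irreducible F (m := c + 1) (by lia)
  have hlarge : 2 * (n / (c + 1)) ≤ S.card := by
    have h : 2 * n ≤ (c + 1) * S.card :=
      (Nat.le_pow_clog hq (2 * n)).trans (by simpa using hcard)
    refine Nat.le_of_mul_le_mul_left ?_ (Nat.succ_pos c)
    have := Nat.mul_div_le n (c + 1)
    lia
  obtain ⟨T, hTS, hT⟩ := Finset.exists_subset_card_eq hlarge
  have hU := centralBinom_le_UpsilonNN (Nat.div_mul_le_self n (c + 1)) T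
    (fun p hp => hS p (hTS hp)) hT
  have ht : (n : ℝ) / ((c : ℝ) + 1) - 1 ≤ ((n / (c + 1) : ℕ) : ℝ) := by
    have h := Nat.lt_div_mul_add (a := n) (Nat.succ_pos c)
    rw [sub_le_iff_le_add, div_le_iff₀ (by positivity)]
    have h' : (n : ℝ) < ((n / (c + 1) : ℕ) : ℝ) * (c + 1) + (c + 1) := by exact_mod_cast h
    linarith
  refine (main_term_le (by linarith) (by linarith) hLl
    (logb_two_pow_three_le (by linarith)) (by positivity) (by linarith) ht).trans ?_
  refine (two_mul_sub_logb_le_logb_centralBinom (by lia) (Nat.div_le_self _ _)).trans ?_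
  exact Real.logb_le_logb_of_le one_lt_two (by exact_mod_cast Nat.centralBinom_pos _)
    (by exact_mod_cast hU)
end

section
/- There exists an absolute constant C > 0 (independent of q and m) such that for every prime power q, every integer m ≥ q², and every maximal s ∈ M_m, one has |ρ(s) − (log_q m)/ln 2| ≤ C·(1 + log_q log_q m). -/
open Polynomial

/-- `ρ(s)`: the maximum multiplicity in `s` of a monic polynomial of degree 1. -/
noncomputable def rho {F : Type} [Field F] (s : F[X]) : ℕ :=
  sSup {r : ℕ | ∃ p : F[X], p.Monic ∧ p.natDegree = 1 ∧ r = multiplicity p s}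

open UniqueFactorizationMonoid

/-- Monic irreducible polynomials. -/
abbrev MonicPrime (F : Type) [Field F] : Type := {p : F[X] // p.Monic ∧ Irreducible p}

/-- The monic polynomial with prescribed multiplicities at the monic irreducibles. -/
noncomputable def ofExponents {F : Type} [Field F] (g : MonicPrime F →₀ ℕ) : F[X] :=
  ((Finsupp.toMultiset g).map Subtype.val).prod

section Algebra

open scoped Classical

variable {F : Type} [Field F]

theorem ofExponents_monic (g : MonicPrime F →₀ ℕ) : (ofExponents g).Monic := by
  unfold ofExponents
  exact monic_multiset_prod_of_monic _ _ fun p _ => p.2.1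

theorem natDegree_ofExponents (g : MonicPrime F →₀ ℕ) :
    (ofExponents g).natDegree = g.sum fun p k => k * p.1.natDegree := by
  unfold ofExponents
  rw [natDegree_multiset_prod_of_monic]
  · rw [Multiset.map_map, Finsupp.toMultiset_map, Finsupp.sum_toMultiset,
      Finsupp.sum_mapDomain_index (by simp) (by intros; ring)]
    rfl
  · intro p hp
    obtain ⟨a, _, rfl⟩ := Multiset.mem_map.1 hp
    exact a.2.1

theorem normalizedFactors_ofExponents (g : MonicPrime F →₀ ℕ) :
    normalizedFactors (ofExponents g) = (Finsupp.toMultiset g).map Subtype.val := by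
  unfold ofExponents
  rw [normalizedFactors_prod_eq]
  · rw [Multiset.map_map]
    refine Multiset.map_congr rfl fun p _ => ?_
    exact p.2.1.normalize_eq_self
  · intro p hp
    obtain ⟨a, _, rfl⟩ := Multiset.mem_map.1 hp
    exact a.2.2

theorem numDiv_eq_card_Iic {s : F[X]} (hs : s.Monic) :
    numDiv s = (Finset.Iic (normalizedFactors s)).card := by
  unfold numDiv
  rw [← Set.ncard_coe_finset]
  refine Set.ncard_congr (fun d _ => normalizedFactors d) ?_ ?_ ?_
  · rintro d ⟨hd, hds⟩
    simpa using (dvd_iff_normalizedFactors_le_normalizedFactors hd.ne_zero hs.ne_zero).1 hds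
  · rintro d e ⟨hd, _⟩ ⟨he, _⟩ h
    exact eq_of_monic_of_associated hd he
      ((associated_iff_normalizedFactors_eq_normalizedFactors hd.ne_zero he.ne_zero).2 h)
  · intro M hM
    have hM' : M ≤ normalizedFactors s := by simpa using hM
    have hmem : ∀ p ∈ M, p ∈ normalizedFactors s := fun p hp => Multiset.mem_of_le hM' hp
    have hmonic : ∀ p ∈ M, p.Monic := fun p hp => by
      rw [← normalize_normalized_factor p (hmem p hp)]
      exact monic_normalize (ne_zero_of_mem_normalizedFactors (hmem p hp))
    have hprod : M.prod.Monic := by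
      have := monic_multiset_prod_of_monic M id hmonic
      simpa using this
    have hnf : normalizedFactors M.prod = M := by
      rw [normalizedFactors_prod_eq]
      · conv_rhs => rw [← Multiset.map_id M]
        exact Multiset.map_congr rfl fun p hp => (hmonic p hp).normalize_eq_self
      · exact fun p hp => irreducible_of_normalized_factor p (hmem p hp)
    refine ⟨M.prod, ⟨hprod, ?_⟩, hnf⟩
    rwa [dvd_iff_normalizedFactors_le_normalizedFactors hprod.ne_zero hs.ne_zero, hnf]

theorem numDiv_ofExponents (g : MonicPrime F →₀ ℕ) :
    numDiv (ofExponents g) = g.prod fun _ k => k + 1 := by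
  rw [numDiv_eq_card_Iic (ofExponents_monic g), Multiset.card_Iic, normalizedFactors_ofExponents,
    Multiset.toFinset_map, Finset.prod_image (Subtype.val_injective.injOn),
    Finsupp.toFinset_toMultiset]
  refine Finset.prod_congr rfl fun p _ => ?_
  rw [Multiset.count_map_eq_count' _ _ Subtype.val_injective, Finsupp.count_toMultiset]

theorem multiplicity_ofExponents (g : MonicPrime F →₀ ℕ) (p : MonicPrime F) :
    multiplicity p.1 (ofExponents g) = g p := by
  have h := emultiplicity_eq_count_normalizedFactors p.2.2 (ofExponents_monic g).ne_zero
  rw [normalizedFactors_ofExponents, p.2.1.normalize_eq_self,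
    Multiset.count_map_eq_count' _ _ Subtype.val_injective, Finsupp.count_toMultiset] at h
  exact multiplicity_eq_of_emultiplicity_eq_some h

theorem exists_ofExponents_eq {s : F[X]} (hs : s.Monic) : ∃ g, ofExponents g = s := by
  have hmem : ∀ p ∈ normalizedFactors s, p.Monic ∧ Irreducible p := fun p hp => by
    refine ⟨?_, irreducible_of_normalized_factor p hp⟩
    rw [← normalize_normalized_factor p hp]
    exact monic_normalize (ne_zero_of_mem_normalizedFactors hp)
  lift normalizedFactors s to Multiset (MonicPrime F) using hmem with M hM
  refine ⟨Multiset.toFinsupp M, eq_of_monic_of_associated (ofExponents_monic _) hs ?_⟩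
  unfold ofExponents
  rw [Multiset.toFinsupp_toMultiset, hM]
  exact prod_normalizedFactors hs.ne_zero

theorem exists_rho_eq (g : MonicPrime F →₀ ℕ) :
    ∃ p : MonicPrime F, p.1.natDegree = 1 ∧ rho (ofExponents g) = g p := by
  have hset : {r : ℕ | ∃ p : F[X], p.Monic ∧ p.natDegree = 1 ∧ r = multiplicity p (ofExponents g)}
      = g '' {p : MonicPrime F | p.1.natDegree = 1} := by
    ext r
    constructor
    · rintro ⟨p, hp, hd, rfl⟩
      have hi : Irreducible p := irreducible_of_degree_eq_one
        ((degree_eq_iff_natDegree_eq_of_pos one_pos).2 hd)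
      exact ⟨⟨p, hp, hi⟩, hd, (multiplicity_ofExponents g ⟨p, hp, hi⟩).symm⟩
    · rintro ⟨p, hd, rfl⟩
      exact ⟨p.1, p.2.1, hd, (multiplicity_ofExponents g p).symm⟩
  unfold rho
  rw [hset]
  have hne : (g '' {p : MonicPrime F | p.1.natDegree = 1}).Nonempty :=
    ⟨_, ⟨X, monic_X, irreducible_X⟩, natDegree_X, rfl⟩
  have hbdd : BddAbove (g '' {p : MonicPrime F | p.1.natDegree = 1}) :=
    (g.finite_range.subset (Set.image_subset_range _ _)).bddAbove
  obtain ⟨p, hd, hp⟩ := Nat.sSup_mem hne hbdd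
  exact ⟨p, hd, hp.symm⟩

theorem exists_finset_natDegree_dvd [Fintype F] {k : ℕ} (hk : k ≠ 0) :
    ∃ S : Finset (MonicPrime F), (∀ p, p ∈ S ↔ p.1.natDegree ∣ k) ∧
      ∑ p ∈ S, p.1.natDegree = Fintype.card F ^ k := by
  have hq : 1 < Fintype.card F := Fintype.one_lt_card
  set G : F[X] := X ^ Fintype.card F ^ k - X with hG
  have hG0 : G ≠ 0 := FiniteField.X_pow_card_pow_sub_X_ne_zero F hk hq
  have hGd : G.natDegree = Fintype.card F ^ k :=
    FiniteField.X_pow_card_pow_sub_X_natDegree_eq F hk hq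
  have hGm : G.Monic := by
    have h1 : 1 < Fintype.card F ^ k := Nat.one_lt_pow hk hq
    exact monic_X_pow_sub (by rw [degree_X]; exact_mod_cast h1)
  have hsq : Squarefree G := by
    refine Separable.squarefree ?_
    have hd : derivative G = -1 := by
      simp [hG, derivative_X_pow, hk]
    rw [separable_def, hd]
    exact isCoprime_one_right.neg_right
  obtain ⟨g, hg⟩ := exists_ofExponents_eq hGm
  have hle : ∀ p, g p ≤ 1 := fun p => by
    have h1 := (squarefree_iff_nodup_normalizedFactors hG0).1 hsq
    rw [← hg, normalizedFactors_ofExponents] at h1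
    have h2 := Multiset.nodup_iff_count_le_one.1 h1 p.1
    rwa [Multiset.count_map_eq_count' _ _ Subtype.val_injective, Finsupp.count_toMultiset] at h2
  refine ⟨g.support, fun p => ?_, ?_⟩
  · rw [p.2.2.natDegree_dvd_iff_dvd_X_pow_card_pow_sub_X, Nat.card_eq_fintype_card, ← hG,
      Finsupp.mem_support_iff, ← multiplicity_ofExponents, hg]
    rw [Ne, multiplicity_eq_zero, not_not]
  · rw [← hGd, ← hg, natDegree_ofExponents]
    refine Finset.sum_congr rfl fun p hp => ?_
    have := hle p
    have h0 := Finsupp.mem_support_iff.1 hp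
    simp [show g p = 1 by omega]

end Algebra

section Exchange

open scoped Classical

variable {P : Type} {deg : P → ℕ} {f : P →₀ ℕ}

/-- Among exponent vectors of no larger weight, `f` has the largest number of divisors. -/
def IsOptimal (deg : P → ℕ) (f : P →₀ ℕ) : Prop :=
  ∀ g : P →₀ ℕ, (g.sum fun p k => k * deg p) ≤ (f.sum fun p k => k * deg p) →
    (g.prod fun _ k => k + 1) ≤ f.prod fun _ k => k + 1

theorem IsOptimal.prod_exchange (hf : IsOptimal deg f) {A B : Finset P} (hAB : Disjoint A B)
    {α β : P → ℕ} (hβ : ∀ p ∈ B, β p ≤ f p)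
    (hdeg : ∑ p ∈ A, α p * deg p ≤ ∑ p ∈ B, β p * deg p) :
    (∏ p ∈ A, (f p + α p + 1)) * ∏ p ∈ B, (f p - β p + 1) ≤
      (∏ p ∈ A, (f p + 1)) * ∏ p ∈ B, (f p + 1) := by
  set S : Finset P := f.support ∪ (A ∪ B) with hS
  let G : P → ℕ := fun p => if p ∈ A then f p + α p else if p ∈ B then f p - β p else f p
  have hGS : ∀ p, G p ≠ 0 → p ∈ S := fun p hp => by
    by_contra h
    simp only [hS, Finset.mem_union, not_or, Finsupp.mem_support_iff, not_not] at h
    simp [G, h] at hp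
  have hsub : A ∪ B ⊆ S := Finset.subset_union_right
  have hnB : ∀ p ∈ B, p ∉ A := fun p hp h => Finset.disjoint_left.1 hAB h hp
  have hGA : ∀ p ∈ A, G p = f p + α p := fun p hp => by simp [G, hp]
  have hGB : ∀ p ∈ B, G p = f p - β p := fun p hp => by simp [G, hp, hnB p hp]
  have hGo : ∀ p ∈ S \ (A ∪ B), G p = f p := fun p hp => by
    simp only [Finset.mem_sdiff, Finset.mem_union, not_or] at hp
    simp [G, hp]
  have hsum : ∀ h : P → ℕ, ∑ p ∈ S, h p * deg p =
      ∑ p ∈ S \ (A ∪ B), h p * deg p + (∑ p ∈ A, h p * deg p + ∑ p ∈ B, h p * deg p) := fun h => by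
    rw [← Finset.sum_union hAB, Finset.sum_sdiff hsub]
  have hprod : ∀ h : P → ℕ, ∏ p ∈ S, (h p + 1) =
      (∏ p ∈ S \ (A ∪ B), (h p + 1)) * ((∏ p ∈ A, (h p + 1)) * ∏ p ∈ B, (h p + 1)) := fun h => by
    rw [← Finset.prod_union hAB, Finset.prod_sdiff hsub]
  have key := hf (Finsupp.onFinset S G hGS) (by
    rw [Finsupp.onFinset_sum _ (by simp),
      Finsupp.sum_of_support_subset f (Finset.subset_union_left : _ ⊆ S) _ (by simp),
      hsum G, hsum f]
    have h1 : ∑ p ∈ S \ (A ∪ B), G p * deg p = ∑ p ∈ S \ (A ∪ B), f p * deg p :=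
      Finset.sum_congr rfl fun p hp => by rw [hGo p hp]
    have h2 : ∑ p ∈ A, G p * deg p = ∑ p ∈ A, f p * deg p + ∑ p ∈ A, α p * deg p := by
      rw [← Finset.sum_add_distrib]
      exact Finset.sum_congr rfl fun p hp => by rw [hGA p hp, add_mul]
    have h3 : ∑ p ∈ B, G p * deg p + ∑ p ∈ B, β p * deg p = ∑ p ∈ B, f p * deg p := by
      rw [← Finset.sum_add_distrib]
      exact Finset.sum_congr rfl fun p hp => by
        rw [hGB p hp, ← add_mul, Nat.sub_add_cancel (hβ p hp)]
    omega)
  rw [Finsupp.onFinset_prod _ (by simp),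
    Finsupp.prod_of_support_subset f (Finset.subset_union_left : _ ⊆ S) _ (by simp),
    hprod G, hprod f,
    Finset.prod_congr rfl (fun p hp => by rw [hGo p hp] :
      ∀ p ∈ S \ (A ∪ B), G p + 1 = f p + 1),
    Finset.prod_congr rfl (fun p hp => by rw [hGA p hp] : ∀ p ∈ A, G p + 1 = f p + α p + 1),
    Finset.prod_congr rfl (fun p hp => by rw [hGB p hp] : ∀ p ∈ B, G p + 1 = f p - β p + 1)] at key
  exact Nat.le_of_mul_le_mul_left key (Finset.prod_pos fun _ _ => Nat.succ_pos _)

theorem IsOptimal.sum_log_exchange (hf : IsOptimal deg f) {A B : Finset P} (hAB : Disjoint A B)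
    {α β : P → ℕ} (hβ : ∀ p ∈ B, β p ≤ f p)
    (hdeg : ∑ p ∈ A, α p * deg p ≤ ∑ p ∈ B, β p * deg p) :
    ∑ p ∈ A, Real.log ((f p + α p + 1) / (f p + 1) : ℝ) ≤
      ∑ p ∈ B, Real.log ((f p + 1) / (f p - β p + 1) : ℝ) := by
  have h := hf.prod_exchange hAB hβ hdeg
  have hB : ∀ p ∈ B, (0 : ℝ) < f p - β p + 1 := fun p hp => by
    have : (β p : ℝ) ≤ f p := by exact_mod_cast hβ p hp
    linarith
  have hR : (∏ p ∈ A, (f p + α p + 1 : ℝ)) * ∏ p ∈ B, (f p - β p + 1 : ℝ) ≤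
      (∏ p ∈ A, (f p + 1 : ℝ)) * ∏ p ∈ B, (f p + 1 : ℝ) := by
    have hc : ∏ p ∈ B, (f p - β p + 1 : ℝ) = ((∏ p ∈ B, (f p - β p + 1) : ℕ) : ℝ) := by
      push_cast
      exact Finset.prod_congr rfl fun p hp => by rw [Nat.cast_sub (hβ p hp)]
    rw [hc]
    exact_mod_cast h
  rw [← Real.log_prod (fun p _ => by positivity),
    ← Real.log_prod (fun p hp => (div_pos (by positivity) (hB p hp)).ne'),
    Finset.prod_div_distrib, Finset.prod_div_distrib]
  have hBp : (0 : ℝ) < ∏ p ∈ B, (f p - β p + 1 : ℝ) := Finset.prod_pos hB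
  refine Real.log_le_log (by positivity) ?_
  rw [div_le_div_iff₀ (by positivity) hBp]
  linarith

/-- Replacing `x ^ deg p` by `p` does not increase the number of divisors. -/
theorem IsOptimal.le_deg_mul (hf : IsOptimal deg f) {x p : P} (hx : deg x = 1) (hp : 0 < deg p) :
    f x + 1 ≤ deg p * (f p + 2) := by
  rcases eq_or_ne x p with rfl | hne
  · rw [hx]; omega
  rcases lt_or_ge (f x) (deg p) with hlt | hle
  · nlinarith
  have h := hf.prod_exchange (A := {p}) (B := {x}) (by simpa using hne.symm)
    (α := fun _ => 1) (β := fun _ => deg p) (by simpa using hle) (by simp [hx])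
  simp only [Finset.prod_singleton] at h
  obtain ⟨c, hc⟩ := Nat.exists_eq_add_of_le hle
  rw [hc, Nat.add_sub_cancel_left] at h
  nlinarith

/-- Replacing `p` by `x ^ deg p` does not increase the number of divisors. -/
theorem IsOptimal.mul_deg_le (hf : IsOptimal deg f) {x p : P} (hx : deg x = 1) :
    f p * deg p ≤ f x + 1 := by
  rcases eq_or_ne x p with rfl | hne
  · rw [hx]; omega
  rcases Nat.eq_zero_or_pos (f p) with h0 | hpos
  · simp [h0]
  have h := hf.prod_exchange (A := {x}) (B := {p}) (by simpa using hne)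
    (α := fun _ => deg p) (β := fun _ => 1)
    (fun r hr => by rw [Finset.mem_singleton.1 hr]; exact hpos) (by simp [hx])
  simp only [Finset.prod_singleton] at h
  obtain ⟨c, hc⟩ := Nat.exists_eq_add_of_le hpos
  rw [hc, Nat.add_sub_cancel_left] at h
  rw [hc]
  nlinarith

/-- Upper bound: trade `D` factors of degree `k` for `k` missing irreducibles of degree `≤ D`. -/
theorem IsOptimal.mul_log_two_le (hf : IsOptimal deg f) {x : P} (hx : deg x = 1) {k D : ℕ}
    (hk : 0 < k) {B A : Finset P} (hB : ∀ p ∈ B, deg p ∣ k) (hBc : B.card = D)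
    (hA : ∀ p ∈ A, f p = 0 ∧ deg p ≤ D) (hAc : A.card = k) :
    (f x + 1 : ℝ) * Real.log 2 ≤ D + 3 * k * Real.log 2 := by
  have hl : 0 < Real.log 2 := Real.log_pos one_lt_two
  rcases le_or_gt (f x + 1) (3 * k) with hsmall | hbig
  · have h1 : (f x + 1 : ℝ) ≤ 3 * k := by exact_mod_cast hsmall
    have := mul_le_mul_of_nonneg_right h1 hl.le
    have : (0 : ℝ) ≤ D := by positivity
    linarith
  have hpos : ∀ p ∈ B, 0 < deg p := fun p hp => Nat.pos_of_dvd_of_pos (hB p hp) hk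
  have hle : ∀ p ∈ B, deg p ≤ k := fun p hp => Nat.le_of_dvd hk (hB p hp)
  have hmul : ∀ p ∈ B, k / deg p * deg p = k := fun p hp => Nat.div_mul_cancel (hB p hp)
  have hβ : ∀ p ∈ B, k / deg p ≤ f p := fun p hp => by
    have h1 := hf.le_deg_mul hx (hpos p hp)
    have h2 := hle p hp
    refine Nat.div_le_of_le_mul ?_
    nlinarith
  have hdisj : Disjoint A B := Finset.disjoint_left.2 fun p hpA hpB => by
    have h1 := hβ p hpB
    have h2 := hmul p hpB
    rw [(hA p hpA).1, Nat.le_zero] at h1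
    rw [h1] at h2
    omega
  have h := hf.sum_log_exchange hdisj (α := fun _ => 1) (β := fun p => k / deg p) hβ (by
    rw [Finset.sum_congr rfl hmul, Finset.sum_const, hBc, smul_eq_mul, mul_comm, ← hAc,
      ← smul_eq_mul]
    refine Finset.sum_le_card_nsmul _ _ _ fun p hp => ?_
    simpa using (hA p hp).2)
  have hAs : ∑ p ∈ A, Real.log ((f p + ((1 : ℕ) : ℝ) + 1) / (f p + 1) : ℝ) = k * Real.log 2 := by
    rw [Finset.sum_congr rfl (fun p hp => by rw [(hA p hp).1] : ∀ p ∈ A, _ =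
      Real.log ((((0 : ℕ) : ℝ) + ((1 : ℕ) : ℝ) + 1) / (((0 : ℕ) : ℝ) + 1))), Finset.sum_const, hAc]
    norm_num
  have hbR : (3 * k : ℝ) < f x + 1 := by exact_mod_cast hbig
  have hkR : (0 : ℝ) < k := by exact_mod_cast hk
  have hden : (0 : ℝ) < f x + 1 - 2 * k := by linarith
  have hBs : ∑ p ∈ B, Real.log ((f p + 1) / (f p - (k / deg p : ℕ) + 1) : ℝ) ≤
      D * (k / (f x + 1 - 2 * k)) := by
    rw [← hBc, ← nsmul_eq_mul]
    refine Finset.sum_le_card_nsmul _ _ _ fun p hp => ?_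
    have hcR : ((k / deg p : ℕ) : ℝ) ≤ f p := by exact_mod_cast hβ p hp
    have hmR : ((k / deg p : ℕ) : ℝ) * deg p = k := by exact_mod_cast hmul p hp
    have hdR : (0 : ℝ) < deg p := by exact_mod_cast hpos p hp
    have hdk : (deg p : ℝ) ≤ k := by exact_mod_cast hle p hp
    have h1 : (f x + 1 : ℝ) ≤ deg p * (f p + 2) := by exact_mod_cast hf.le_deg_mul hx (hpos p hp)
    generalize ((k / deg p : ℕ) : ℝ) = c at *
    have hw : (0 : ℝ) < f p - c + 1 := by linarith
    refine (Real.log_le_sub_one_of_pos (by positivity)).trans ?_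
    rw [div_sub_one hw.ne', div_le_div_iff₀ hw hden]
    have hc0 : 0 ≤ c := by
      by_contra hneg
      nlinarith
    have h2 : (f x + 1 - 2 * k : ℝ) ≤ deg p * (f p - c + 1) := by nlinarith
    calc (f p + 1 - (f p - c + 1)) * (f x + 1 - 2 * k : ℝ) = c * (f x + 1 - 2 * k) := by ring
      _ ≤ c * (deg p * (f p - c + 1)) := mul_le_mul_of_nonneg_left h2 hc0
      _ = k * (f p - c + 1) := by rw [← hmR]; ring
  rw [hAs] at h
  have h3 := h.trans hBs
  rw [mul_div_assoc', le_div_iff₀ hden] at h3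
  have h4 : Real.log 2 * (f x + 1 - 2 * k) ≤ D := by
    refine le_of_mul_le_mul_left ?_ hkR
    linarith
  have h5 : 0 ≤ k * Real.log 2 := by positivity
  linarith

/-- Lower bound: trade `k` irreducible factors of degree `≥ D` for `D` factors of degree `k`. -/
theorem IsOptimal.le_mul_log_two (hf : IsOptimal deg f) {x : P} (hx : deg x = 1) {k D : ℕ}
    (hk : 0 < k) (hkD : k < D) {A B : Finset P} (hA : ∀ p ∈ A, deg p ∣ k) (hAc : A.card = D)
    (hB : ∀ p ∈ B, f p ≠ 0 ∧ D ≤ deg p) (hBc : B.card = k) :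
    (D : ℝ) ≤ (f x + 1 + 2 * k) * Real.log 2 := by
  have hpos : ∀ p ∈ A, 0 < deg p := fun p hp => Nat.pos_of_dvd_of_pos (hA p hp) hk
  have hle : ∀ p ∈ A, deg p ≤ k := fun p hp => Nat.le_of_dvd hk (hA p hp)
  have hmul : ∀ p ∈ A, k / deg p * deg p = k := fun p hp => Nat.div_mul_cancel (hA p hp)
  have hdisj : Disjoint A B := Finset.disjoint_left.2 fun p hpA hpB => by
    have h1 := (hB p hpB).2
    have h2 := hle p hpA
    omega
  have h := hf.sum_log_exchange hdisj (α := fun p => k / deg p) (β := fun _ => 1)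
    (fun p hp => Nat.one_le_iff_ne_zero.2 (hB p hp).1) (by
    rw [Finset.sum_congr rfl hmul, Finset.sum_const, hAc, smul_eq_mul, mul_comm, ← hBc,
      ← smul_eq_mul]
    refine Finset.card_nsmul_le_sum _ _ _ fun p hp => ?_
    simpa using (hB p hp).2)
  have hkR : (0 : ℝ) < k := by exact_mod_cast hk
  have hden : (0 : ℝ) < f x + 1 + 2 * k := by positivity
  have hBs : ∑ p ∈ B, Real.log ((f p + 1) / (f p - ((1 : ℕ) : ℝ) + 1) : ℝ) ≤ k * Real.log 2 := by
    rw [← hBc, ← nsmul_eq_mul]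
    refine Finset.sum_le_card_nsmul _ _ _ fun p hp => ?_
    have h1 : (1 : ℝ) ≤ f p := by exact_mod_cast Nat.one_le_iff_ne_zero.2 (hB p hp).1
    have h2 : (0 : ℝ) < f p - ((1 : ℕ) : ℝ) + 1 := by push_cast; linarith
    refine Real.log_le_log (by positivity) ?_
    rw [div_le_iff₀ h2]
    push_cast
    linarith
  have hAs : D * (k / (f x + 1 + 2 * k) : ℝ) ≤
      ∑ p ∈ A, Real.log ((f p + (k / deg p : ℕ) + 1) / (f p + 1) : ℝ) := by
    rw [← hAc, ← nsmul_eq_mul]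
    refine Finset.card_nsmul_le_sum _ _ _ fun p hp => ?_
    have hmR : ((k / deg p : ℕ) : ℝ) * deg p = k := by exact_mod_cast hmul p hp
    have hdR : (0 : ℝ) < deg p := by exact_mod_cast hpos p hp
    have hdk : (deg p : ℝ) ≤ k := by exact_mod_cast hle p hp
    have h1 : (f p * deg p : ℝ) ≤ f x + 1 := by exact_mod_cast hf.mul_deg_le (p := p) hx
    have hc0 : (0 : ℝ) ≤ (k / deg p : ℕ) := by positivity
    generalize ((k / deg p : ℕ) : ℝ) = c at *
    have hw : (0 : ℝ) < f p + c + 1 := by positivity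
    refine le_trans ?_ (Real.one_sub_inv_le_log_of_pos (by positivity))
    rw [inv_div, one_sub_div hw.ne', div_le_div_iff₀ hden hw]
    have h2 : deg p * (f p + c + 1) ≤ (f x + 1 + 2 * k : ℝ) := by nlinarith
    calc k * (f p + c + 1) = c * (deg p * (f p + c + 1)) := by rw [← hmR]; ring
      _ ≤ c * (f x + 1 + 2 * k) := mul_le_mul_of_nonneg_left h2 hc0
      _ = (f p + c + 1 - (f p + 1)) * (f x + 1 + 2 * k) := by ring
  have h3 := hAs.trans (h.trans hBs)
  rw [mul_div_assoc', div_le_iff₀ hden] at h3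
  refine le_of_mul_le_mul_right ?_ hkR
  linarith

end Exchange

section Counting

open scoped Classical

variable {P : Type} {deg : P → ℕ} {f : P →₀ ℕ} {q : ℕ}

/-- The elements whose degree divides `k` have total degree `q ^ k`, as is the case for the
irreducible factors of `X ^ q ^ k - X`. -/
def HasDegreeSums (deg : P → ℕ) (q : ℕ) : Prop :=
  ∀ k ≠ 0, ∃ S : Finset P, (∀ p, p ∈ S ↔ deg p ∣ k) ∧ ∑ p ∈ S, deg p = q ^ k

theorem two_mul_le_two_pow {j : ℕ} (hj : j ≠ 0) : 2 * j ≤ 2 ^ j := by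
  obtain ⟨i, rfl⟩ := Nat.exists_eq_succ_of_ne_zero hj
  have := Nat.lt_two_pow_self (n := i)
  rw [pow_succ]
  omega

theorem HasDegreeSums.exists_card_eq (hP : HasDegreeSums deg q) (hq : 2 ≤ q) {j D : ℕ}
    (hj : j ≠ 0) (hD : D ≤ q ^ j) :
    ∃ S : Finset P, (∀ p ∈ S, deg p ∣ 2 * j) ∧ S.card = D := by
  obtain ⟨S, hS, hsum⟩ := hP (2 * j) (by omega)
  have h1 : q ^ (2 * j) ≤ S.card * (2 * j) := by
    rw [← hsum, ← smul_eq_mul]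
    exact Finset.sum_le_card_nsmul _ _ _ fun p hp => Nat.le_of_dvd (by omega) ((hS p).1 hp)
  have h2 : q ^ j * (2 * j) ≤ S.card * (2 * j) := by
    refine le_trans ?_ h1
    rw [two_mul, pow_add]
    refine Nat.mul_le_mul_left _ ?_
    rw [← two_mul]
    exact (two_mul_le_two_pow hj).trans (Nat.pow_le_pow_left hq j)
  have h3 : q ^ j ≤ S.card := Nat.le_of_mul_le_mul_right h2 (by omega)
  obtain ⟨T, hTS, hT⟩ := Finset.exists_subset_card_eq (hD.trans h3)
  exact ⟨T, fun p hp => (hS p).1 (hTS hp), hT⟩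

theorem HasDegreeSums.exists_missing (hP : HasDegreeSums deg q) {k D : ℕ} (hD : D ≠ 0)
    (h : (f.sum fun p k => k * deg p) + k * D < q ^ D) :
    ∃ A : Finset P, (∀ p ∈ A, f p = 0 ∧ deg p ≤ D) ∧ A.card = k := by
  obtain ⟨S, hS, hsum⟩ := hP D hD
  have hle : ∀ p ∈ S, deg p ≤ D := fun p hp => Nat.le_of_dvd (Nat.pos_of_ne_zero hD) ((hS p).1 hp)
  have h1 : ∑ p ∈ S with f p = 0, deg p ≤ (S.filter fun p => f p = 0).card * D := by
    rw [← smul_eq_mul]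
    exact Finset.sum_le_card_nsmul _ _ _ fun p hp => hle p (Finset.mem_filter.1 hp).1
  have h2 : ∑ p ∈ S with ¬ f p = 0, deg p ≤ f.sum fun p k => k * deg p := by
    calc ∑ p ∈ S with ¬ f p = 0, deg p ≤ ∑ p ∈ S with ¬ f p = 0, f p * deg p :=
          Finset.sum_le_sum fun p hp =>
            Nat.le_mul_of_pos_left _ (Nat.pos_of_ne_zero (Finset.mem_filter.1 hp).2)
      _ ≤ _ := Finset.sum_le_sum_of_subset fun p hp =>
            Finsupp.mem_support_iff.2 (Finset.mem_filter.1 hp).2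
  have h3 := Finset.sum_filter_add_sum_filter_not S (fun p => f p = 0) deg
  have h4 : k ≤ (S.filter fun p => f p = 0).card := by
    by_contra hlt
    have := Nat.mul_le_mul_right D (not_le.1 hlt).le
    omega
  obtain ⟨A, hAS, hA⟩ := Finset.exists_subset_card_eq h4
  exact ⟨A, fun p hp => ⟨(Finset.mem_filter.1 (hAS hp)).2,
    hle p (Finset.mem_filter.1 (hAS hp)).1⟩, hA⟩

theorem HasDegreeSums.card_le (hP : HasDegreeSums deg q) (hq : 2 ≤ q) (hdeg : ∀ p, 0 < deg p)
    (D : ℕ) (T : Finset P) (hT : ∀ p ∈ T, deg p < D) : T.card ≤ q ^ D := by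
  induction D generalizing T with
  | zero =>
    rw [Finset.eq_empty_of_forall_notMem fun p hp => absurd (hT p hp) (Nat.not_lt_zero _)]
    simp
  | succ D ih =>
    have h1 := ih (T.filter fun p => deg p < D) fun p hp => (Finset.mem_filter.1 hp).2
    have h2 : (T.filter fun p => ¬ deg p < D).card ≤ q ^ D := by
      rcases eq_or_ne D 0 with rfl | hD
      · have he : (T.filter fun p => ¬ deg p < 0) = ∅ :=
          Finset.eq_empty_of_forall_notMem fun p hp => by
            have h3 := hT p (Finset.mem_filter.1 hp).1
            have h4 := hdeg p
            omega
        rw [he, Finset.card_empty]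
        exact Nat.zero_le _
      · obtain ⟨S, hS, hsum⟩ := hP D hD
        rw [← hsum]
        refine le_trans (Finset.card_le_card fun p hp => (hS p).2 ?_)
          (Finset.card_eq_sum_ones S ▸ Finset.sum_le_sum fun p _ => hdeg p)
        obtain ⟨h3, h4⟩ := Finset.mem_filter.1 hp
        have h5 := hT p h3
        rw [show deg p = D by omega]
    have h3 := Finset.card_filter_add_card_filter_not (s := T) (fun p => deg p < D)
    rw [pow_succ]
    nlinarith

theorem IsOptimal.exists_large (hf : IsOptimal deg f) (hP : HasDegreeSums deg q) (hq : 2 ≤ q)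
    (hdeg : ∀ p, 0 < deg p) {x : P} (hx : deg x = 1) {k D : ℕ}
    (h : (f x + 1) * (q ^ D + k) < f.sum fun p k => k * deg p) :
    ∃ B : Finset P, (∀ p ∈ B, f p ≠ 0 ∧ D ≤ deg p) ∧ B.card = k := by
  have h1 : k ≤ (f.support.filter fun p => ¬ deg p < D).card := by
    by_contra hlt
    have h2 := hP.card_le hq hdeg D (f.support.filter fun p => deg p < D)
      fun p hp => (Finset.mem_filter.1 hp).2
    have h3 := Finset.card_filter_add_card_filter_not (s := f.support) (fun p => deg p < D)
    have h4 : (f.sum fun p k => k * deg p) ≤ f.support.card * (f x + 1) := by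
      rw [← smul_eq_mul]
      exact Finset.sum_le_card_nsmul _ _ _ fun p _ => hf.mul_deg_le hx
    have h5 : f.support.card ≤ q ^ D + k := by omega
    have := Nat.mul_le_mul_right (f x + 1) h5
    nlinarith
  obtain ⟨B, hBS, hB⟩ := Finset.exists_subset_card_eq h1
  refine ⟨B, fun p hp => ?_, hB⟩
  obtain ⟨h2, h3⟩ := Finset.mem_filter.1 (hBS hp)
  exact ⟨Finsupp.mem_support_iff.1 h2, not_lt.1 h3⟩

theorem sq_le_two_pow_succ (n : ℕ) : n ^ 2 ≤ 2 ^ (n + 1) := by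
  rcases lt_or_ge n 4 with h | h
  · interval_cases n <;> norm_num
  · induction n, h using Nat.le_induction with
    | base => norm_num
    | succ n hn ih =>
      rw [pow_succ 2 (n + 1)]
      nlinarith

theorem mul_sq_lt_two_pow (n : ℕ) (hn : 13 ≤ n) : 18 * n ^ 2 * 2 < 2 ^ n := by
  induction n, hn using Nat.le_induction with
  | base => norm_num
  | succ n hn ih =>
    rw [pow_succ 2 n]
    nlinarith

theorem IsOptimal.upper_bound (hf : IsOptimal deg f) (hP : HasDegreeSums deg q) (hq : 2 ≤ q)
    {x : P} (hx : deg x = 1) {n t : ℕ} (hn : 2 ≤ n) (ht : q ^ t ≤ n) (ht' : n < q ^ (t + 1))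
    (hm : (f.sum fun p k => k * deg p) < q ^ (n + 1)) :
    (f x + 1 : ℝ) * Real.log 2 ≤ n + 6 + 6 * (t + 3) * Real.log 2 := by
  have htn : t + 3 ≤ 3 * n := by
    have h1 := Nat.lt_two_pow_self (n := t)
    have h2 := Nat.pow_le_pow_left hq t
    omega
  obtain ⟨B, hB, hBc⟩ := hP.exists_card_eq hq (j := t + 3) (D := n + 6) (by omega) (by
    have h1 : q ^ (t + 3) = q ^ (t + 1) * (q * q) := by ring
    have h2 : 2 * 2 ≤ q * q := Nat.mul_le_mul hq hq
    have h3 := Nat.mul_le_mul ht'.le h2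
    rw [h1]
    omega)
  obtain ⟨A, hA, hAc⟩ := hP.exists_missing (f := f) (k := 2 * (t + 3)) (D := n + 6) (by omega) (by
    have h1 : q ^ (n + 6) = q ^ (n + 1) * q ^ 5 := by ring
    have h2 : 2 ^ 5 ≤ q ^ 5 := Nat.pow_le_pow_left hq 5
    have h3 := Nat.mul_le_mul_left (q ^ (n + 1)) h2
    have h4 := (sq_le_two_pow_succ n).trans (Nat.pow_le_pow_left hq (n + 1))
    have h5 : 2 * (t + 3) * (n + 6) ≤ (6 * n) * (4 * n) :=
      Nat.mul_le_mul (by omega) (by omega)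
    rw [h1]
    nlinarith)
  have h := hf.mul_log_two_le hx (by omega) hB hBc hA hAc
  push_cast at h
  linarith

theorem IsOptimal.lower_bound (hf : IsOptimal deg f) (hP : HasDegreeSums deg q) (hq : 2 ≤ q)
    (hdeg : ∀ p, 0 < deg p) {x : P} (hx : deg x = 1) {n t : ℕ} (hn : 13 ≤ n) (ht : q ^ t ≤ n)
    (ht' : n < q ^ (t + 1)) (hm : q ^ n ≤ f.sum fun p k => k * deg p) (hxn : f x + 1 ≤ 3 * n) :
    (n : ℝ) ≤ 3 * t + 10 ∨ (n : ℝ) ≤ t + 4 + (f x + 1 + 4 * (t + 3)) * Real.log 2 := by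
  rcases le_or_gt n (3 * t + 10) with hsmall | hbig
  · left
    exact_mod_cast hsmall
  right
  obtain ⟨D, rfl⟩ : ∃ D, n = D + t + 4 := ⟨n - t - 4, by omega⟩
  have htn : t + 3 ≤ 3 * (D + t + 4) := by omega
  have hqpos : 0 < q := by omega
  obtain ⟨A, hA, hAc⟩ := hP.exists_card_eq hq (j := t + 3) (D := D) (by omega) (by
    have h1 : q ^ (t + 1) ≤ q ^ (t + 3) := Nat.pow_le_pow_right hqpos (by omega)
    omega)
  obtain ⟨B, hB, hBc⟩ := hf.exists_large hP hq hdeg hx (k := 2 * (t + 3)) (D := D) (by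
    refine lt_of_lt_of_le ?_ hm
    have h1 : (f x + 1) * q ^ D ≤ q ^ (D + t + 3) := by
      have h2 : q ^ (D + t + 3) = (q * q) * q ^ (t + 1) * q ^ D := by ring
      have h3 : 2 * 2 ≤ q * q := Nat.mul_le_mul hq hq
      rw [h2]
      refine Nat.mul_le_mul_right _ (hxn.trans ?_)
      have := Nat.mul_le_mul h3 ht'.le
      omega
    have h4 : (f x + 1) * (2 * (t + 3)) ≤ (3 * (D + t + 4)) * (6 * (D + t + 4)) :=
      Nat.mul_le_mul hxn (by omega)
    have h5 := mul_sq_lt_two_pow _ hn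
    have h6 : 2 ^ (D + t + 4) = 2 * 2 ^ (D + t + 3) := by ring
    have h7 : 2 ^ (D + t + 3) ≤ q ^ (D + t + 3) := Nat.pow_le_pow_left hq _
    have h8 : q ^ (D + t + 4) = q * q ^ (D + t + 3) := by ring
    have h9 := Nat.mul_le_mul_right (q ^ (D + t + 3)) hq
    rw [mul_add, h8]
    have h10 : (3 * (D + t + 4)) * (6 * (D + t + 4)) = 18 * (D + t + 4) ^ 2 := by ring
    omega)
  have h := hf.le_mul_log_two hx (by omega) (by omega) hA hAc hB hBc
  push_cast at h ⊢
  linarith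

theorem IsOptimal.abs_sub_le (hf : IsOptimal deg f) (hP : HasDegreeSums deg q) (hq : 2 ≤ q)
    (hdeg : ∀ p, 0 < deg p) {x : P} (hx : deg x = 1) {m : ℕ} (hm : q ^ 2 ≤ m)
    (hfm : (f.sum fun p k => k * deg p) = m) :
    |(f x : ℝ) - Real.logb q m / Real.log 2| ≤
      100 * (1 + Real.logb q (Real.logb q m)) := by
  have hm0 : m ≠ 0 := by
    have : 0 < q ^ 2 := by positivity
    omega
  obtain ⟨n, hn⟩ : ∃ n, n = Nat.log q m := ⟨_, rfl⟩
  obtain ⟨t, ht⟩ : ∃ t, t = Nat.log q n := ⟨_, rfl⟩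
  have hn2 : 2 ≤ n := hn ▸ Nat.le_log_of_pow_le (by omega) hm
  have hnm : q ^ n ≤ m := hn ▸ Nat.pow_log_le_self q hm0
  have hmn : m < q ^ (n + 1) := hn ▸ Nat.lt_pow_succ_log_self (by omega) m
  have htn : q ^ t ≤ n := ht ▸ Nat.pow_log_le_self q (by omega)
  have hnt : n < q ^ (t + 1) := ht ▸ Nat.lt_pow_succ_log_self (by omega) n
  have hqR : (1 : ℝ) < q := by exact_mod_cast hq
  have hmR : (0 : ℝ) < m := by exact_mod_cast Nat.pos_of_ne_zero hm0
  set l : ℝ := Real.logb q m with hl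
  have hnl : (n : ℝ) ≤ l := by
    rw [hl, Real.le_logb_iff_rpow_le hqR hmR, Real.rpow_natCast]
    exact_mod_cast hnm
  have hln : l < n + 1 := by
    rw [hl, Real.logb_lt_iff_lt_rpow hqR hmR]
    exact_mod_cast hmn
  have hnR : (2 : ℝ) ≤ n := by exact_mod_cast hn2
  have hlt : (t : ℝ) ≤ Real.logb q l := by
    rw [Real.le_logb_iff_rpow_le hqR (by linarith), Real.rpow_natCast]
    refine le_trans ?_ hnl
    exact_mod_cast htn
  have ht0 : (0 : ℝ) ≤ t := by positivity
  have hx0 : (0 : ℝ) ≤ f x := by positivity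
  set L := Real.log 2 with hL
  have hL1 : 0.69 < L := by have := Real.log_two_gt_d9; linarith
  have hL2 : L < 0.7 := by have := Real.log_two_lt_d9; linarith
  have hL0 : 0 < L := by linarith
  have hup := hf.upper_bound hP hq hx hn2 htn hnt (hfm ▸ hmn)
  rw [← hL] at hup
  have hdiv : l / L * L = l := div_mul_cancel₀ _ hL0.ne'
  set y := l / L with hy
  have htL : 0.69 * (t : ℝ) ≤ t * L := by nlinarith
  suffices h : |(f x : ℝ) - y| ≤ 100 * (1 + t) by linarith
  rw [abs_le]
  constructor
  · by_contra hlow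
    have hxy : (f x : ℝ) + 100 * (1 + t) < y := by linarith
    have hxl : ((f x : ℝ) + 100 * (1 + t)) * L < l := by
      rw [← hdiv]
      exact mul_lt_mul_of_pos_right hxy hL0
    have hxL : 0 ≤ (f x : ℝ) * L := by positivity
    have hn13 : 13 ≤ n := by
      by_contra hlt13
      have : (n : ℝ) ≤ 12 := by exact_mod_cast (by omega : n ≤ 12)
      nlinarith
    have hxn : f x + 1 ≤ 3 * n := by
      have h1 : (f x : ℝ) + 1 ≤ 3 * n := by nlinarith
      exact_mod_cast h1
    rcases hf.lower_bound hP hq hdeg hx hn13 htn hnt (hfm ▸ hnm) hxn with h | h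
    · nlinarith
    · rw [← hL] at h
      nlinarith
  · by_contra hhigh
    have hxy : y + 100 * (1 + t) < (f x : ℝ) := by linarith
    have hxl : l + 100 * (1 + t) * L < f x * L := by
      rw [← hdiv, ← add_mul]
      exact mul_lt_mul_of_pos_right hxy hL0
    nlinarith

end Counting

/-- Proposition 4: there is an absolute constant `C > 0` such that for every finite field
`F` (of prime-power size `q = |F|`), every integer `m ≥ q²`, and every maximal `s ∈ M_m`,
`|ρ(s) − (log_q m)/ln 2| ≤ C·(1 + log_q log_q m)`. -/
theorem rho_asymptotics :
    ∃ C : ℝ, 0 < C ∧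
      ∀ (F : Type) [Field F] [Fintype F], ∀ m : ℕ, Fintype.card F ^ 2 ≤ m →
        ∀ s : F[X], IsMaximal m s →
          |(rho s : ℝ) - Real.logb (Fintype.card F) m / Real.log 2| ≤
            C * (1 + Real.logb (Fintype.card F) (Real.logb (Fintype.card F) m)) := by
  refine ⟨100, by norm_num, fun F _ _ m hm s hs => ?_⟩
  obtain ⟨hmonic, hdeg, hmax⟩ := hs
  obtain ⟨f, rfl⟩ := exists_ofExponents_eq hmonic
  obtain ⟨x, hx, hrho⟩ := exists_rho_eq f
  rw [natDegree_ofExponents] at hdeg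
  have hf : IsOptimal (fun p : MonicPrime F => p.1.natDegree) f := fun g hg => by
    rw [← numDiv_ofExponents, ← numDiv_ofExponents]
    refine hmax _ (ofExponents_monic g) ?_
    rw [natDegree_ofExponents, ← hdeg]
    exact hg
  rw [hrho]
  exact hf.abs_sub_le (fun k hk => exists_finset_natDegree_dvd hk) Fintype.one_lt_card
    (fun p => p.2.2.natDegree_pos) hx hm hdeg
end
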